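/- Let u ∈ C^∞(ℝ⁴), set f := Δ²u and R := −6e^{−2u}(Δu + |∇u|²). Assume: ∫_{ℝ⁴}|f| dx < ∞; the metric is normal, i.e. u(x) = (1/(8π²)) ∫_{ℝ⁴} log(|y|/|x−y|) f(y) dy + C for some constant C; ∫_{ℝ⁴} R² e^{4u} dx < ∞; and the function div(e^{2u}∇R) is Lebesgue integrable on ℝ⁴. Then ∫_{ℝ⁴} div(e^{2u}∇R(x)) dx = 0, i.e. ∫_{M⁴} Δ_g R_g dv_g = 0 for g = e^{2u}|dx|². -/

import Mathlib

open MeasureTheory Metric Filter Set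

noncomputable section

/-- Euclidean space `ℝⁿ`. -/
abbrev Eu (n : ℕ) := EuclideanSpace ℝ (Fin n)

/-- The Euclidean Laplacian `Δu(x) = ∑ᵢ ∂²u/∂xᵢ²`. -/
def lap {n : ℕ} (u : Eu n → ℝ) (x : Eu n) : ℝ :=
  ∑ i : Fin n, iteratedFDeriv ℝ 2 u x ![EuclideanSpace.single i 1, EuclideanSpace.single i 1]

/-- Iterated Laplacian `Δᵏ`. -/
def lapIter {n : ℕ} : ℕ → (Eu n → ℝ) → Eu n → ℝ
  | 0, u => u
  | k + 1, u => lap (lapIter k u)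

/-- The Euclidean divergence of a vector field `W : ℝⁿ → ℝⁿ`. -/
def divergence {n : ℕ} (W : Eu n → Eu n) (x : Eu n) : ℝ :=
  ∑ i : Fin n, fderiv ℝ W x (EuclideanSpace.single i 1) i


lemma integrableOn_ball_norm_inv_sq (r : ℝ) :
    IntegrableOn (fun x : Eu 4 => ‖x‖⁻¹ ^ 2) (ball 0 r) := by
  rw [integrableOn_fun_norm_addHaar (μ := volume) (f := fun s : ℝ => s⁻¹ ^ 2)]
  refine (integrableOn_congr_fun (g := fun s : ℝ => s) ?_ measurableSet_Ioo).mpr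
    ((continuous_id.integrableOn_Icc (a := 0) (b := r)).mono_set Ioo_subset_Icc_self)
  intro s hs
  have : s ≠ 0 := hs.1.ne'
  simp only [finrank_euclideanSpace, Fintype.card_fin, smul_eq_mul]
  field_simp

lemma setLIntegral_ball_norm_inv_sq {r : ℝ} (hr : 0 < r) :
    ∫⁻ x in ball (0 : Eu 4) r, ENNReal.ofReal (‖x‖⁻¹ ^ 2) =
      ENNReal.ofReal (r ^ 2) * ∫⁻ x in ball (0 : Eu 4) 1, ENNReal.ofReal (‖x‖⁻¹ ^ 2) := by
  rw [← ofReal_integral_eq_lintegral_ofReal (integrableOn_ball_norm_inv_sq r)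
      (Eventually.of_forall fun x => by positivity),
    ← ofReal_integral_eq_lintegral_ofReal (integrableOn_ball_norm_inv_sq 1)
      (Eventually.of_forall fun x => by positivity), ← ENNReal.ofReal_mul (by positivity)]
  congr 1
  have h := Measure.setIntegral_comp_smul_of_pos (volume : Measure (Eu 4))
    (fun x : Eu 4 => ‖x‖⁻¹ ^ 2) (ball 0 1) hr
  rw [smul_unitBall_of_pos hr] at h
  simp only [norm_smul, Real.norm_of_nonneg hr.le, mul_inv, mul_pow, finrank_euclideanSpace,
    Fintype.card_fin, smul_eq_mul, integral_const_mul] at h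
  field_simp at h ⊢
  linarith

lemma setLIntegral_ball_norm_sub_inv_sq (a : Eu 4) (r : ℝ) :
    ∫⁻ x in ball a r, ENNReal.ofReal (‖x - a‖⁻¹ ^ 2) =
      ∫⁻ x in ball (0 : Eu 4) r, ENNReal.ofReal (‖x‖⁻¹ ^ 2) := by
  rw [← lintegral_indicator measurableSet_ball, ← lintegral_indicator measurableSet_ball,
    ← lintegral_sub_right_eq_self ((ball 0 r).indicator _) a]
  refine lintegral_congr fun x => ?_
  simp only [indicator, mem_ball, dist_eq_norm, sub_zero]

/-- The kernel `|x - a|⁻²` has mass `O(r²)` on balls of radius `r`, uniformly in the pole. -/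
lemma exists_setLIntegral_norm_sub_inv_sq_le :
    ∃ c : ENNReal, c ≠ ⊤ ∧ ∀ (a : Eu 4) (r : ℝ), 0 < r →
      ∫⁻ x in ball (0 : Eu 4) r, ENNReal.ofReal (‖x - a‖⁻¹ ^ 2) ≤ c * ENNReal.ofReal (r ^ 2) := by
  refine ⟨(∫⁻ x in ball (0 : Eu 4) 1, ENNReal.ofReal (‖x‖⁻¹ ^ 2)) + volume (ball (0 : Eu 4) 1),
    ?_, fun a r hr => ?_⟩
  · refine ENNReal.add_ne_top.2 ⟨?_, measure_ball_lt_top.ne⟩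
    rw [← ofReal_integral_eq_lintegral_ofReal (integrableOn_ball_norm_inv_sq 1)
      (Eventually.of_forall fun x => by positivity)]
    exact ENNReal.ofReal_ne_top
  have hsub : ball (0 : Eu 4) r ⊆ ball a r ∪ (ball 0 r \ ball a r) := by
    rw [union_sdiff_self]; exact subset_union_right
  calc _ ≤ ∫⁻ x in ball a r ∪ (ball 0 r \ ball a r), ENNReal.ofReal (‖x - a‖⁻¹ ^ 2) :=
        lintegral_mono_set hsub
    _ ≤ (∫⁻ x in ball a r, ENNReal.ofReal (‖x - a‖⁻¹ ^ 2)) +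
          ∫⁻ x in ball 0 r \ ball a r, ENNReal.ofReal (‖x - a‖⁻¹ ^ 2) := lintegral_union_le _ _ _
    _ ≤ ENNReal.ofReal (r ^ 2) * (∫⁻ x in ball (0 : Eu 4) 1, ENNReal.ofReal (‖x‖⁻¹ ^ 2)) +
          ENNReal.ofReal (r ^ 2) * volume (ball (0 : Eu 4) 1) := by
        gcongr ?_ + ?_
        · rw [setLIntegral_ball_norm_sub_inv_sq, setLIntegral_ball_norm_inv_sq hr]
        · calc _ ≤ ∫⁻ _ in ball 0 r \ ball a r, ENNReal.ofReal (r⁻¹ ^ 2) := by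
                refine setLIntegral_mono (by fun_prop) fun x hx => ENNReal.ofReal_le_ofReal ?_
                have h : r ≤ ‖x - a‖ := by simpa [dist_eq_norm] using hx.2
                gcongr
            _ ≤ ENNReal.ofReal (r⁻¹ ^ 2) * volume (ball (0 : Eu 4) r) := by
                rw [setLIntegral_const]; gcongr; exact sdiff_subset
            _ = _ := by
                rw [Measure.addHaar_ball_of_pos _ _ hr, ← mul_assoc,
                  ← ENNReal.ofReal_mul (by positivity)]
                congr 2
                simp only [finrank_euclideanSpace, Fintype.card_fin]
                field_simp
    _ = _ := by ring

lemma abs_log_sub_log_le {a b : ℝ} (ha : 0 < a) (hb : 0 < b) :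
    |Real.log a - Real.log b| ≤ |a - b| * (a⁻¹ + b⁻¹) := by
  have key : ∀ s t : ℝ, 0 < s → 0 < t → Real.log s - Real.log t ≤ |s - t| * (s⁻¹ + t⁻¹) := by
    intro s t hs ht
    rw [← Real.log_div hs.ne' ht.ne']
    calc _ ≤ s / t - 1 := Real.log_le_sub_one_of_pos (by positivity)
      _ = (s - t) * t⁻¹ := by field_simp
      _ ≤ |s - t| * t⁻¹ := by gcongr; exact le_abs_self _
      _ ≤ _ := by gcongr; simpa using hs.le
  refine abs_le.2 ⟨?_, key a b ha hb⟩
  have := key b a hb ha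
  rw [abs_sub_comm, add_comm] at this
  linarith

/-- The Riesz-type potential `∫ |x - y|⁻¹ |f(y)| dy`. -/
def invNormPotential (f : Eu 4 → ℝ) (x : Eu 4) : ENNReal :=
  ∫⁻ y, ENNReal.ofReal ‖x - y‖⁻¹ * ‖f y‖ₑ

lemma measurable_invNormPotential {f : Eu 4 → ℝ} (hf : Measurable f) :
    Measurable (invNormPotential f) := by
  unfold invNormPotential
  exact Measurable.lintegral_prod_right' (f := fun p : Eu 4 × Eu 4 =>
    ENNReal.ofReal ‖p.1 - p.2‖⁻¹ * ‖f p.2‖ₑ) (by fun_prop)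

lemma invNormPotential_sq_le {f : Eu 4 → ℝ} (hf : Measurable f) (x : Eu 4) :
    invNormPotential f x ^ 2 ≤
      (∫⁻ y, ‖f y‖ₑ) * ∫⁻ y, ENNReal.ofReal (‖x - y‖⁻¹ ^ 2) * ‖f y‖ₑ := by
  have h := ENNReal.lintegral_mul_le_Lp_mul_Lq
    (volume.withDensity fun y => ‖f y‖ₑ) Real.HolderConjugate.two_two
    (f := fun y => ENNReal.ofReal ‖x - y‖⁻¹) (g := fun _ => 1) (by fun_prop) (by fun_prop)
  have h2 := pow_le_pow_left' h 2
  rw [mul_pow] at h2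
  simp only [Pi.mul_apply, mul_one, ENNReal.rpow_two] at h2
  simp only [← ENNReal.rpow_two, ← ENNReal.rpow_mul] at h2
  norm_num at h2
  rw [lintegral_withDensity_eq_lintegral_mul _ (by fun_prop) (by fun_prop),
    lintegral_withDensity_eq_lintegral_mul _ (by fun_prop) (by fun_prop)] at h2
  simp only [Pi.mul_apply] at h2
  unfold invNormPotential
  rw [mul_comm (∫⁻ y, ‖f y‖ₑ)]
  simpa only [mul_comm, ENNReal.ofReal_pow (inv_nonneg.2 (norm_nonneg _))] using h2

/-- The square of the potential of an integrable density has mass `O(r²)` on balls of radius `r`,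
uniformly under translations. -/
lemma exists_setLIntegral_invNormPotential_sq_le {f : Eu 4 → ℝ} (hf : Measurable f)
    (hfi : Integrable f) :
    ∃ c : ENNReal, c ≠ ⊤ ∧ ∀ (z : Eu 4) (r : ℝ), 0 < r →
      ∫⁻ x in ball (0 : Eu 4) r, invNormPotential f (x + z) ^ 2 ≤ c * ENNReal.ofReal (r ^ 2) := by
  obtain ⟨c, hc, hK⟩ := exists_setLIntegral_norm_sub_inv_sq_le
  have hI : ∫⁻ y, ‖f y‖ₑ ≠ ⊤ := hfi.2.ne
  refine ⟨(∫⁻ y, ‖f y‖ₑ) * (c * ∫⁻ y, ‖f y‖ₑ), by finiteness, fun z r hr => ?_⟩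
  calc _ ≤ ∫⁻ x in ball (0 : Eu 4) r, (∫⁻ y, ‖f y‖ₑ) *
            ∫⁻ y, ENNReal.ofReal (‖x + z - y‖⁻¹ ^ 2) * ‖f y‖ₑ :=
        lintegral_mono fun x => invNormPotential_sq_le hf _
    _ = (∫⁻ y, ‖f y‖ₑ) * ∫⁻ y, (∫⁻ x in ball (0 : Eu 4) r,
          ENNReal.ofReal (‖x + z - y‖⁻¹ ^ 2)) * ‖f y‖ₑ := by
        rw [lintegral_const_mul' _ _ hI, lintegral_lintegral_swap (by fun_prop)]
        congr 1
        refine lintegral_congr fun y => ?_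
        rw [lintegral_mul_const _ (by fun_prop)]
    _ ≤ (∫⁻ y, ‖f y‖ₑ) * ∫⁻ y, (c * ENNReal.ofReal (r ^ 2)) * ‖f y‖ₑ := by
        gcongr with y
        simpa only [sub_sub_eq_add_sub] using hK (y - z) r hr
    _ = _ := by
        rw [lintegral_const_mul _ (by fun_prop)]; ring

lemma ennreal_add_sq_le (a b : ENNReal) : (a + b) ^ 2 ≤ 2 * (a ^ 2 + b ^ 2) := by
  have h := ENNReal.rpow_add_le_mul_rpow_add_rpow a b (p := 2) one_le_two
  norm_num at h
  exact h

lemma invNormPotential_ne_top {f : Eu 4 → ℝ} (hf : Continuous f) (hfi : Integrable f)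
    (x : Eu 4) : invNormPotential f x ≠ ⊤ := by
  obtain ⟨M, hM⟩ := (isCompact_closedBall x 1).exists_bound_of_continuousOn hf.continuousOn
  have hloc : ∫⁻ y in ball x 1, ENNReal.ofReal (‖y - x‖⁻¹ ^ 2) ≠ ⊤ := by
    rw [setLIntegral_ball_norm_sub_inv_sq,
      ← ofReal_integral_eq_lintegral_ofReal (integrableOn_ball_norm_inv_sq 1)
        (Eventually.of_forall fun x => by positivity)]
    exact ENNReal.ofReal_ne_top
  have hI : ∫⁻ y, ‖f y‖ₑ ≠ ⊤ := hfi.2.ne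
  have hmf := hf.measurable
  unfold invNormPotential
  rw [← lintegral_add_compl _ (measurableSet_ball (x := x) (ε := 1))]
  refine ENNReal.add_ne_top.2 ⟨ne_top_of_le_ne_top
    (b := (∫⁻ y in ball x 1, ENNReal.ofReal (‖y - x‖⁻¹ ^ 2)) * ENNReal.ofReal M)
    (by finiteness) ?_, ne_top_of_le_ne_top hI ?_⟩
  · rw [← lintegral_mul_const _ (by fun_prop)]
    refine setLIntegral_mono (by fun_prop) fun y hy => ?_
    have hy1 : ‖x - y‖ < 1 := by simpa [dist_eq_norm, norm_sub_rev] using hy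
    gcongr
    · rw [norm_sub_rev y x]
      rcases (norm_nonneg (x - y)).eq_or_lt with h | h
      · simp [← h]
      · exact le_self_pow₀ ((one_le_inv₀ h).2 hy1.le) two_ne_zero
    · rw [← ofReal_norm]
      exact ENNReal.ofReal_le_ofReal (hM y (ball_subset_closedBall hy))
  · refine (setLIntegral_mono (g := fun y => ‖f y‖ₑ) (by fun_prop) fun y hy => ?_).trans
      (setLIntegral_le_lintegral _ _)
    have hy1 : 1 ≤ ‖x - y‖ := by simpa [dist_eq_norm, norm_sub_rev] using hy
    calc _ ≤ ENNReal.ofReal 1 * ‖f y‖ₑ := by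
          gcongr
          exact inv_le_one_of_one_le₀ hy1
      _ = _ := by simp

/-- Differences of logarithmic kernels are controlled by `invNormPotential`. -/
lemma lintegral_log_sub_log_le {f : Eu 4 → ℝ} (hf : Measurable f) (x z : Eu 4) :
    ∫⁻ y, ‖(Real.log ‖z - y‖ - Real.log ‖x - y‖) * f y‖ₑ ≤
      ENNReal.ofReal ‖z - x‖ * (invNormPotential f z + invNormPotential f x) := by
  unfold invNormPotential
  rw [← lintegral_add_left (by fun_prop), ← lintegral_const_mul _ (by fun_prop)]
  refine lintegral_mono_ae ?_
  have hz : ∀ᵐ y : Eu 4, y ≠ z := by simp [ae_iff]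
  have hx : ∀ᵐ y : Eu 4, y ≠ x := by simp [ae_iff]
  filter_upwards [hz, hx] with y hyz hyx
  rw [enorm_mul, ← add_mul, ← mul_assoc]
  gcongr
  rw [← ENNReal.ofReal_add (by positivity) (by positivity), ← ENNReal.ofReal_mul (by positivity),
    ← ofReal_norm]
  refine ENNReal.ofReal_le_ofReal ?_
  refine (abs_log_sub_log_le (norm_pos_iff.2 (sub_ne_zero.2 hyz.symm))
    (norm_pos_iff.2 (sub_ne_zero.2 hyx.symm))).trans ?_
  gcongr
  simpa using abs_norm_sub_norm_le (z - y) (x - y)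

lemma integrable_log_sub_log_mul {f : Eu 4 → ℝ} (hf : Continuous f) (hfi : Integrable f)
    (x z : Eu 4) :
    Integrable fun y => (Real.log ‖z - y‖ - Real.log ‖x - y‖) * f y := by
  have hmf := hf.measurable
  have hx := invNormPotential_ne_top hf hfi x
  have hz := invNormPotential_ne_top hf hfi z
  refine ⟨by fun_prop, (lintegral_log_sub_log_le hmf x z).trans_lt ?_⟩
  finiteness

lemma log_div_mul_ae_eq (f : Eu 4 → ℝ) (w : Eu 4) :
    (fun y => Real.log (‖y‖ / ‖w - y‖) * f y) =ᵐ[volume]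
      fun y => (Real.log ‖0 - y‖ - Real.log ‖w - y‖) * f y := by
  have hw : ∀ᵐ y : Eu 4, y ≠ w := by simp [ae_iff]
  have h0 : ∀ᵐ y : Eu 4, y ≠ 0 := by simp [ae_iff]
  filter_upwards [hw, h0] with y hyw hy0
  rw [Real.log_div (norm_ne_zero_iff.2 hy0) (norm_ne_zero_iff.2 (sub_ne_zero.2 hyw.symm)),
    zero_sub, norm_neg]

lemma integrable_log_div_mul {f : Eu 4 → ℝ} (hf : Continuous f) (hfi : Integrable f)
    (x : Eu 4) : Integrable fun y => Real.log (‖y‖ / ‖x - y‖) * f y :=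
  (integrable_log_sub_log_mul hf hfi x 0).congr (log_div_mul_ae_eq f x).symm

/-- Increments of the logarithmic potential of `f` are controlled by `invNormPotential`. -/
lemma enorm_logPotential_sub_le {f : Eu 4 → ℝ} (hf : Continuous f) (hfi : Integrable f)
    (x z : Eu 4) :
    ‖(∫ y, Real.log (‖y‖ / ‖z - y‖) * f y) - ∫ y, Real.log (‖y‖ / ‖x - y‖) * f y‖ₑ ≤
      ENNReal.ofReal ‖z - x‖ * (invNormPotential f z + invNormPotential f x) := by
  rw [integral_congr_ae (log_div_mul_ae_eq f z), integral_congr_ae (log_div_mul_ae_eq f x),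
    ← integral_sub (integrable_log_sub_log_mul hf hfi z 0)
      (integrable_log_sub_log_mul hf hfi x 0)]
  refine (enorm_integral_le_lintegral_enorm _).trans ?_
  refine le_trans (le_of_eq (lintegral_congr fun y => ?_))
    (lintegral_log_sub_log_le hf.measurable x z)
  rw [← enorm_neg]
  congr 1
  ring

/-- If `u` is, up to constants, the logarithmic potential of an integrable density, then
`∫_{B_r} |∂_v u|² = O(r²)`. -/
lemma exists_setLIntegral_fderiv_sq_le {u f : Eu 4 → ℝ} (hu : Differentiable ℝ u)
    (hf : Continuous f) (hfi : Integrable f) {a C : ℝ}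
    (hnormal : ∀ x, u x = a * (∫ y, Real.log (‖y‖ / ‖x - y‖) * f y) + C) (v : Eu 4) :
    ∃ c : ENNReal, c ≠ ⊤ ∧ ∀ r : ℝ, 0 < r →
      ∫⁻ x in ball (0 : Eu 4) r, ‖fderiv ℝ u x v‖ₑ ^ 2 ≤ c * ENNReal.ofReal (r ^ 2) := by
  obtain ⟨c, hc, hV⟩ := exists_setLIntegral_invNormPotential_sq_le hf.measurable hfi
  have hmV := measurable_invNormPotential hf.measurable
  refine ⟨(‖a‖ₑ * ‖v‖ₑ) ^ 2 * (4 * c), by finiteness, fun r hr => ?_⟩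
  let D : ℕ → Eu 4 → ℝ := fun n x => ((n : ℝ) + 1) * (u (x + ((n : ℝ) + 1)⁻¹ • v) - u x)
  have hlim : ∀ x, Tendsto (fun n => ‖D n x‖ₑ ^ 2) atTop (nhds (‖fderiv ℝ u x v‖ₑ ^ 2)) := by
    intro x
    have hn : Tendsto (fun n : ℕ => (n : ℝ) + 1) atTop atTop :=
      tendsto_atTop_add_const_right _ _ tendsto_natCast_atTop_atTop
    exact ENNReal.Tendsto.pow (((hu x).hasFDerivAt.lim_real v).comp hn).enorm
  have hD : ∀ n x, ‖D n x‖ₑ ^ 2 ≤ (‖a‖ₑ * ‖v‖ₑ) ^ 2 *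
      (2 * (invNormPotential f (x + ((n : ℝ) + 1)⁻¹ • v) ^ 2 + invNormPotential f (x + 0) ^ 2)) := by
    intro n x
    have hn : (0 : ℝ) < (n : ℝ) + 1 := by positivity
    have h := enorm_logPotential_sub_le hf hfi x (x + ((n : ℝ) + 1)⁻¹ • v)
    have h1 : ‖D n x‖ₑ ≤ (‖a‖ₑ * ‖v‖ₑ) *
        (invNormPotential f (x + ((n : ℝ) + 1)⁻¹ • v) + invNormPotential f (x + 0)) := by
      have hDe : D n x = ((n : ℝ) + 1) * (a *
          ((∫ y, Real.log (‖y‖ / ‖x + ((n : ℝ) + 1)⁻¹ • v - y‖) * f y) -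
            ∫ y, Real.log (‖y‖ / ‖x - y‖) * f y)) := by
        simp only [D]
        rw [hnormal (x + _), hnormal x]
        ring
      rw [hDe, enorm_mul, enorm_mul, add_zero]
      refine (mul_le_mul_right (mul_le_mul_right h _) _).trans (le_of_eq ?_)
      rw [add_sub_cancel_left, ofReal_norm, enorm_smul, enorm_inv hn.ne']
      have h0 : ‖(n : ℝ) + 1‖ₑ ≠ 0 := by simpa using hn.ne'
      have ht : ‖(n : ℝ) + 1‖ₑ ≠ ⊤ := enorm_ne_top
      calc _ = (‖(n : ℝ) + 1‖ₑ * ‖(n : ℝ) + 1‖ₑ⁻¹) * (‖a‖ₑ * ‖v‖ₑ *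
            (invNormPotential f (x + ((n : ℝ) + 1)⁻¹ • v) + invNormPotential f x)) := by ring
        _ = _ := by rw [ENNReal.mul_inv_cancel h0 ht, one_mul]
    refine (pow_le_pow_left' h1 2).trans ?_
    rw [mul_pow]
    gcongr
    exact ennreal_add_sq_le _ _
  have hmD : ∀ n, Measurable fun x => ‖D n x‖ₑ ^ 2 := fun n => by
    have := hu.continuous.measurable
    fun_prop
  calc ∫⁻ x in ball (0 : Eu 4) r, ‖fderiv ℝ u x v‖ₑ ^ 2
      = ∫⁻ x in ball (0 : Eu 4) r, liminf (fun n => ‖D n x‖ₑ ^ 2) atTop :=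
        lintegral_congr fun x => (hlim x).liminf_eq.symm
    _ ≤ liminf (fun n => ∫⁻ x in ball (0 : Eu 4) r, ‖D n x‖ₑ ^ 2) atTop :=
        lintegral_liminf_le hmD
    _ ≤ liminf (fun _ : ℕ => (‖a‖ₑ * ‖v‖ₑ) ^ 2 * (4 * c) * ENNReal.ofReal (r ^ 2)) atTop := by
        refine liminf_le_liminf (Eventually.of_forall fun n => ?_)
        refine (lintegral_mono (hD n)).trans ?_
        rw [lintegral_const_mul _ (by fun_prop), lintegral_const_mul _ (by fun_prop),
          lintegral_add_left (by fun_prop), mul_assoc]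
        refine mul_le_mul_right ?_ _
        calc _ ≤ 2 * (c * ENNReal.ofReal (r ^ 2) + c * ENNReal.ofReal (r ^ 2)) := by
              gcongr
              · exact hV _ r hr
              · exact hV _ r hr
          _ = _ := by ring
    _ = _ := by simp

lemma exists_setIntegral_fderiv_sq_le {u f : Eu 4 → ℝ} (hu : ContDiff ℝ (⊤ : ℕ∞) u)
    (hf : Continuous f) (hfi : Integrable f) {a C : ℝ}
    (hnormal : ∀ x, u x = a * (∫ y, Real.log (‖y‖ / ‖x - y‖) * f y) + C) (v : Eu 4) :
    ∃ c : ℝ, ∀ r : ℝ, 0 < r → ∫ x in ball (0 : Eu 4) r, fderiv ℝ u x v ^ 2 ≤ c * r ^ 2 := by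
  obtain ⟨c, hc, h⟩ :=
    exists_setLIntegral_fderiv_sq_le (hu.differentiable (by simp)) hf hfi hnormal v
  have hcont : Continuous fun x => fderiv ℝ u x v :=
    (hu.continuous_fderiv (by simp)).clm_apply continuous_const
  refine ⟨c.toReal, fun r hr => ?_⟩
  rw [integral_eq_lintegral_of_nonneg_ae (Eventually.of_forall fun x => by positivity)
    (by fun_prop)]
  refine ENNReal.toReal_le_of_le_ofReal (by positivity) ?_
  rw [ENNReal.ofReal_mul (by positivity), ENNReal.ofReal_toReal hc]
  refine le_trans (le_of_eq (lintegral_congr fun x => ?_)) (h r hr)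
  rw [← ofReal_norm, ← ENNReal.ofReal_pow (norm_nonneg _), Real.norm_eq_abs, sq_abs]

/-- A smooth bump on `ℝ⁴`, equal to `1` on the unit ball and supported in the ball of radius 2. -/
def unitBump : ContDiffBump (0 : Eu 4) := ⟨1, 2, one_pos, one_lt_two⟩

/-- The rescaled cutoff `x ↦ χ(x / ρ)`. -/
def cutoff (ρ : ℝ) (x : Eu 4) : ℝ := unitBump (ρ⁻¹ • x)

lemma contDiff_cutoff (ρ : ℝ) : ContDiff ℝ (⊤ : ℕ∞) (cutoff ρ) :=
  unitBump.contDiff.comp (contDiff_const_smul _)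

lemma cutoff_of_norm_le {ρ : ℝ} (hρ : 0 < ρ) {x : Eu 4} (hx : ‖x‖ ≤ ρ) : cutoff ρ x = 1 := by
  refine unitBump.one_of_mem_closedBall ?_
  rw [mem_closedBall_zero_iff, norm_smul, norm_inv, Real.norm_of_nonneg hρ.le, inv_mul_le_iff₀ hρ]
  simpa [unitBump] using hx

lemma cutoff_of_le_norm {ρ : ℝ} (hρ : 0 < ρ) {x : Eu 4} (hx : 2 * ρ ≤ ‖x‖) : cutoff ρ x = 0 := by
  refine unitBump.zero_of_le_dist ?_
  rw [dist_zero_right, norm_smul, norm_inv, Real.norm_of_nonneg hρ.le, le_inv_mul_iff₀ hρ]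
  simpa [unitBump, mul_comm] using hx

lemma norm_cutoff_le_one (ρ : ℝ) (x : Eu 4) : ‖cutoff ρ x‖ ≤ 1 := by
  rw [cutoff, Real.norm_of_nonneg unitBump.nonneg]
  exact unitBump.le_one

lemma hasCompactSupport_cutoff {ρ : ℝ} (hρ : 0 < ρ) : HasCompactSupport (cutoff ρ) :=
  HasCompactSupport.of_support_subset_isCompact (isCompact_closedBall 0 (2 * ρ)) fun x hx => by
    by_contra h
    exact hx (cutoff_of_le_norm hρ (by simpa using (not_le.1 (by simpa using h)).le))

lemma fderiv_cutoff (ρ : ℝ) (x v : Eu 4) :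
    fderiv ℝ (cutoff ρ) x v = ρ⁻¹ * fderiv ℝ unitBump (ρ⁻¹ • x) v := by
  unfold cutoff
  rw [fderiv_comp_smul]
  simp

lemma fderiv_fderiv_cutoff (ρ : ℝ) (x v : Eu 4) :
    fderiv ℝ (fun z => fderiv ℝ (cutoff ρ) z v) x v =
      ρ⁻¹ ^ 2 * fderiv ℝ (fun z => fderiv ℝ unitBump z v) (ρ⁻¹ • x) v := by
  simp only [fderiv_cutoff]
  have hd : Differentiable ℝ fun z : Eu 4 => fderiv ℝ unitBump z v :=
    ((unitBump.contDiff (n := 2)).fderiv_right (m := 1) (by norm_num)).clm_apply contDiff_const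
      |>.differentiable (by simp)
  rw [fderiv_const_mul (by fun_prop), fderiv_comp_smul (f := fun z => fderiv ℝ unitBump z v)]
  simp only [smul_apply, smul_eq_mul]
  ring

/-- The first and second derivatives of `cutoff ρ` are `O(ρ⁻¹)` and `O(ρ⁻²)`. -/
lemma exists_abs_fderiv_cutoff_le (v : Eu 4) :
    ∃ A : ℝ, ∀ ρ : ℝ, 0 < ρ → ∀ x, |fderiv ℝ (cutoff ρ) x v| ≤ A * ρ⁻¹ ∧
      |fderiv ℝ (fun z => fderiv ℝ (cutoff ρ) z v) x v| ≤ A * ρ⁻¹ ^ 2 := by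
  have h1 : ContDiff ℝ 1 fun z : Eu 4 => fderiv ℝ unitBump z v :=
    ((unitBump.contDiff (n := 2)).fderiv_right (m := 1) (by norm_num)).clm_apply contDiff_const
  have hs1 : HasCompactSupport fun z : Eu 4 => fderiv ℝ unitBump z v :=
    unitBump.hasCompactSupport.fderiv_apply ℝ v
  obtain ⟨A, hA⟩ := h1.continuous.bounded_above_of_compact_support hs1
  obtain ⟨B, hB⟩ := ((h1.continuous_fderiv (by simp)).clm_apply
    continuous_const).bounded_above_of_compact_support (hs1.fderiv_apply ℝ v)
  refine ⟨max A B, fun ρ hρ x => ⟨?_, ?_⟩⟩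
  · rw [fderiv_cutoff, abs_mul, abs_of_pos (inv_pos.2 hρ), mul_comm]
    gcongr
    exact (hA _).trans (le_max_left _ _)
  · rw [fderiv_fderiv_cutoff, abs_mul, abs_of_pos (by positivity), mul_comm]
    gcongr
    exact (hB _).trans (le_max_right _ _)

lemma fderiv_cutoff_eq_zero {ρ : ℝ} (hρ : 0 < ρ) {x : Eu 4} (hx : ‖x‖ < ρ ∨ 2 * ρ < ‖x‖)
    (v : Eu 4) : fderiv ℝ (cutoff ρ) x v = 0 := by
  rcases hx with hx | hx
  · have h : cutoff ρ =ᶠ[nhds x] fun _ => 1 := by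
      filter_upwards [(isOpen_lt continuous_norm continuous_const).mem_nhds hx] with y hy
      exact cutoff_of_norm_le hρ (le_of_lt hy)
    simp [h.fderiv_eq]
  · have h : cutoff ρ =ᶠ[nhds x] fun _ => 0 := by
      filter_upwards [(isOpen_lt continuous_const continuous_norm).mem_nhds hx] with y hy
      exact cutoff_of_le_norm hρ (le_of_lt hy)
    simp [h.fderiv_eq]

lemma fderiv_fderiv_cutoff_eq_zero {ρ : ℝ} (hρ : 0 < ρ) {x : Eu 4}
    (hx : ‖x‖ < ρ ∨ 2 * ρ < ‖x‖) (v : Eu 4) :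
    fderiv ℝ (fun z => fderiv ℝ (cutoff ρ) z v) x v = 0 := by
  have h : (fun z => fderiv ℝ (cutoff ρ) z v) =ᶠ[nhds x] fun _ => 0 := by
    have hopen : IsOpen {y : Eu 4 | ‖y‖ < ρ ∨ 2 * ρ < ‖y‖} :=
      (isOpen_lt continuous_norm continuous_const).union
        (isOpen_lt continuous_const continuous_norm)
    filter_upwards [hopen.mem_nhds hx] with y hy
    exact fderiv_cutoff_eq_zero hρ hy v
  simp [h.fderiv_eq]

lemma contDiff_fderiv_apply {g : Eu 4 → ℝ} (hg : ContDiff ℝ (⊤ : ℕ∞) g) (v : Eu 4) :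
    ContDiff ℝ (⊤ : ℕ∞) fun x => fderiv ℝ g x v :=
  (hg.fderiv_right (by simp)).clm_apply contDiff_const

/-- The coefficient `∂ᵥ∂ᵥφ + 2 ∂ᵥφ ∂ᵥu` produced by moving `∂ᵥ(e^{2u} ∂ᵥ ·)` onto `φ`. -/
def cutoffWeight (u φ : Eu 4 → ℝ) (v x : Eu 4) : ℝ :=
  fderiv ℝ (fun z => fderiv ℝ φ z v) x v + 2 * fderiv ℝ φ x v * fderiv ℝ u x v

lemma continuous_cutoffWeight {u φ : Eu 4 → ℝ} (hu : ContDiff ℝ (⊤ : ℕ∞) u)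
    (hφ : ContDiff ℝ (⊤ : ℕ∞) φ) (v : Eu 4) : Continuous (cutoffWeight u φ v) :=
  ((contDiff_fderiv_apply (contDiff_fderiv_apply hφ v) v).add
    ((contDiff_const.mul (contDiff_fderiv_apply hφ v)).mul (contDiff_fderiv_apply hu v))).continuous

lemma hasCompactSupport_cutoffWeight {u φ : Eu 4 → ℝ} (hφ : HasCompactSupport φ) (v : Eu 4) :
    HasCompactSupport (cutoffWeight u φ v) := by
  have h1 : HasCompactSupport fun x => fderiv ℝ φ x v := hφ.fderiv_apply ℝ v
  have h2 : HasCompactSupport fun x => 2 * fderiv ℝ φ x v := h1.mul_left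
  exact (h1.fderiv_apply ℝ v).add h2.mul_right

lemma cutoffWeight_cutoff_eq_zero (u : Eu 4 → ℝ) {ρ : ℝ} (hρ : 0 < ρ) {x : Eu 4}
    (hx : ‖x‖ < ρ ∨ 2 * ρ < ‖x‖) (v : Eu 4) : cutoffWeight u (cutoff ρ) v x = 0 := by
  simp [cutoffWeight, fderiv_cutoff_eq_zero hρ hx, fderiv_fderiv_cutoff_eq_zero hρ hx]

/-- Integrating by parts twice against the weighted second-order operator `∂ᵥ(e^{2u} ∂ᵥ ·)`. -/
lemma integral_mul_fderiv_exp_mul_fderiv {u R φ : Eu 4 → ℝ} (hu : ContDiff ℝ (⊤ : ℕ∞) u)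
    (hR : ContDiff ℝ (⊤ : ℕ∞) R) (hφ : ContDiff ℝ (⊤ : ℕ∞) φ) (hφs : HasCompactSupport φ)
    (v : Eu 4) :
    ∫ x, φ x * fderiv ℝ (fun z => Real.exp (2 * u z) * fderiv ℝ R z v) x v =
      ∫ x, cutoffWeight u φ v x * (Real.exp (2 * u x) * R x) := by
  have hd {g : Eu 4 → ℝ} (hg : ContDiff ℝ (⊤ : ℕ∞) g) := contDiff_fderiv_apply hg v
  have hE : ContDiff ℝ (⊤ : ℕ∞) fun x => Real.exp (2 * u x) := (contDiff_const.mul hu).exp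
  have hW : ContDiff ℝ (⊤ : ℕ∞) fun x => Real.exp (2 * u x) * fderiv ℝ R x v := hE.mul (hd hR)
  have hP : ContDiff ℝ (⊤ : ℕ∞) fun x => fderiv ℝ φ x v * Real.exp (2 * u x) := (hd hφ).mul hE
  have hφ's : HasCompactSupport fun x => fderiv ℝ φ x v := hφs.fderiv_apply ℝ v
  have hPs : HasCompactSupport fun x => fderiv ℝ φ x v * Real.exp (2 * u x) := hφ's.mul_right
  rw [integral_mul_fderiv_eq_neg_fderiv_mul_of_integrable
    (((hd hφ).continuous.mul hW.continuous).integrable_of_hasCompactSupport hφ's.mul_right)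
    ((hφ.continuous.mul (hd hW).continuous).integrable_of_hasCompactSupport hφs.mul_right)
    ((hφ.continuous.mul hW.continuous).integrable_of_hasCompactSupport hφs.mul_right)
    (fun x _ => hφ.differentiable (by simp) x) (fun x _ => hW.differentiable (by simp) x)]
  simp only [← mul_assoc]
  rw [integral_mul_fderiv_eq_neg_fderiv_mul_of_integrable
    (((hd hP).continuous.mul hR.continuous).integrable_of_hasCompactSupport
      (hPs.fderiv_apply ℝ v).mul_right)
    ((hP.continuous.mul (hd hR).continuous).integrable_of_hasCompactSupport hPs.mul_right)
    ((hP.continuous.mul hR.continuous).integrable_of_hasCompactSupport hPs.mul_right)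
    (fun x _ => hP.differentiable (by simp) x) (fun x _ => hR.differentiable (by simp) x), neg_neg]
  congr 1 with x
  have hu' := hu.differentiable (by simp) x
  rw [fderiv_fun_mul ((hd hφ).differentiable (by simp) x) (hE.differentiable (by simp) x),
    fderiv_exp (by fun_prop), fderiv_const_mul hu']
  simp only [add_apply, smul_apply, smul_eq_mul, cutoffWeight]
  ring

lemma exists_integral_cutoff_sq_le {u : Eu 4 → ℝ} (hu : ContDiff ℝ (⊤ : ℕ∞) u) {v : Eu 4} {c : ℝ}
    (hc : ∀ r : ℝ, 0 < r → ∫ x in ball (0 : Eu 4) r, fderiv ℝ u x v ^ 2 ≤ c * r ^ 2) :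
    ∃ K : ℝ, ∀ ρ : ℝ, 0 < ρ → ∫ x, cutoffWeight u (cutoff ρ) v x ^ 2 ≤ K := by
  obtain ⟨A, hA⟩ := exists_abs_fderiv_cutoff_le v
  have hcont : Continuous fun x => fderiv ℝ u x v :=
    (hu.continuous_fderiv (by simp)).clm_apply continuous_const
  refine ⟨162 * A ^ 2 * volume.real (ball (0 : Eu 4) 1) + 72 * A ^ 2 * c, fun ρ hρ => ?_⟩
  have hr : (0 : ℝ) < 3 * ρ := by positivity
  have hi : IntegrableOn (fun x => fderiv ℝ u x v ^ 2) (ball (0 : Eu 4) (3 * ρ)) :=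
    ((hcont.pow 2).continuousOn.integrableOn_compact (isCompact_closedBall 0 (3 * ρ))).mono_set
      ball_subset_closedBall
  have hi' : IntegrableOn (fun x => 2 * A ^ 2 * ρ⁻¹ ^ 4 + 8 * A ^ 2 * ρ⁻¹ ^ 2 *
      fderiv ℝ u x v ^ 2) (ball (0 : Eu 4) (3 * ρ)) :=
    (integrableOn_const measure_ball_lt_top.ne).add (hi.const_mul _)
  calc _ ≤ ∫ x, (ball (0 : Eu 4) (3 * ρ)).indicator (fun x => 2 * A ^ 2 * ρ⁻¹ ^ 4 +
          8 * A ^ 2 * ρ⁻¹ ^ 2 * fderiv ℝ u x v ^ 2) x := by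
        refine integral_mono_of_nonneg (Eventually.of_forall fun x => by positivity)
          ((integrable_indicator_iff measurableSet_ball).2 hi') (Eventually.of_forall fun x => ?_)
        by_cases hx : x ∈ ball (0 : Eu 4) (3 * ρ)
        · rw [indicator_of_mem hx]
          obtain ⟨h1, h2⟩ := hA ρ hρ x
          have h1' := sq_le_sq' (abs_le.1 h1).1 (abs_le.1 h1).2
          have h2' := sq_le_sq' (abs_le.1 h2).1 (abs_le.1 h2).2
          calc _ ≤ 2 * (fderiv ℝ (fun z => fderiv ℝ (cutoff ρ) z v) x v ^ 2 +
                (2 * fderiv ℝ (cutoff ρ) x v * fderiv ℝ u x v) ^ 2) := add_sq_le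
            _ = 2 * fderiv ℝ (fun z => fderiv ℝ (cutoff ρ) z v) x v ^ 2 +
                8 * fderiv ℝ (cutoff ρ) x v ^ 2 * fderiv ℝ u x v ^ 2 := by ring
            _ ≤ 2 * (A * ρ⁻¹ ^ 2) ^ 2 + 8 * (A * ρ⁻¹) ^ 2 * fderiv ℝ u x v ^ 2 := by gcongr
            _ = _ := by ring
        · rw [indicator_of_notMem hx]
          have hx' : 2 * ρ < ‖x‖ := by
            rw [mem_ball_zero_iff, not_lt] at hx
            linarith
          simp [cutoffWeight_cutoff_eq_zero u hρ (Or.inr hx')]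
    _ = 2 * A ^ 2 * ρ⁻¹ ^ 4 * volume.real (ball (0 : Eu 4) (3 * ρ)) +
          8 * A ^ 2 * ρ⁻¹ ^ 2 * ∫ x in ball (0 : Eu 4) (3 * ρ), fderiv ℝ u x v ^ 2 := by
        rw [integral_indicator measurableSet_ball,
          integral_add (integrableOn_const measure_ball_lt_top.ne).integrable (hi.const_mul _), setIntegral_const,
          integral_const_mul, smul_eq_mul, mul_comm (volume.real _)]
    _ ≤ 2 * A ^ 2 * ρ⁻¹ ^ 4 * ((3 * ρ) ^ 4 * volume.real (ball (0 : Eu 4) 1)) +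
          8 * A ^ 2 * ρ⁻¹ ^ 2 * (c * (3 * ρ) ^ 2) := by
        gcongr
        · rw [Measure.real, Measure.addHaar_ball_of_pos _ _ hr, ENNReal.toReal_mul,
            ENNReal.toReal_ofReal (by positivity), finrank_euclideanSpace, Fintype.card_fin,
            Measure.real]
        · exact hc _ hr
    _ = _ := by
        field_simp
        ring

lemma abs_mul_le_add_sq {ε : ℝ} (hε : 0 < ε) (a b : ℝ) :
    |a * b| ≤ ε * a ^ 2 + ε⁻¹ * b ^ 2 := by
  have h := sq_nonneg (ε * |a| - |b|)
  rw [abs_mul, ← sq_abs a, ← sq_abs b]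
  field_simp
  nlinarith [mul_nonneg (abs_nonneg a) (abs_nonneg b), sq_nonneg |a|, sq_nonneg |b|,
    mul_nonneg hε.le (mul_nonneg (abs_nonneg a) (abs_nonneg b))]

lemma exists_abs_integral_cutoff_mul_le {u R : Eu 4 → ℝ} (hu : ContDiff ℝ (⊤ : ℕ∞) u)
    (hR : ContDiff ℝ (⊤ : ℕ∞) R)
    (hRL2 : Integrable fun x => R x ^ 2 * Real.exp (4 * u x)) {v : Eu 4} {c : ℝ}
    (hc : ∀ r : ℝ, 0 < r → ∫ x in ball (0 : Eu 4) r, fderiv ℝ u x v ^ 2 ≤ c * r ^ 2) :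
    ∃ K : ℝ, ∀ ε : ℝ, 0 < ε → ∀ ρ : ℝ, 0 < ρ →
      |∫ x, cutoff ρ x * fderiv ℝ (fun z => Real.exp (2 * u z) * fderiv ℝ R z v) x v| ≤
        ε * K + ε⁻¹ * ∫ x in (ball (0 : Eu 4) ρ)ᶜ, R x ^ 2 * Real.exp (4 * u x) := by
  obtain ⟨K, hK⟩ := exists_integral_cutoff_sq_le hu hc
  refine ⟨K, fun ε hε ρ hρ => ?_⟩
  have hφ := contDiff_cutoff ρ
  have hφs := hasCompactSupport_cutoff hρ
  rw [integral_mul_fderiv_exp_mul_fderiv hu hR hφ hφs]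
  have hgc := continuous_cutoffWeight hu hφ v
  have hgs := hasCompactSupport_cutoffWeight (u := u) hφs v
  have hg0 : ∀ x ∈ ball (0 : Eu 4) ρ, cutoffWeight u (cutoff ρ) v x = 0 := fun x hx =>
    cutoffWeight_cutoff_eq_zero u hρ (Or.inl (by simpa using hx)) v
  have hKρ := hK ρ hρ
  generalize cutoffWeight u (cutoff ρ) v = g at hgc hgs hg0 hKρ ⊢
  have hgs2 : HasCompactSupport fun x => g x ^ 2 := by
    simp only [pow_two]
    exact hgs.mul_right
  have hg2 : Integrable fun x => g x ^ 2 := (hgc.pow 2).integrable_of_hasCompactSupport hgs2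
  have ht : Integrable ((ball (0 : Eu 4) ρ)ᶜ.indicator fun x => R x ^ 2 * Real.exp (4 * u x)) :=
    hRL2.indicator measurableSet_ball.compl
  calc |∫ x, g x * (Real.exp (2 * u x) * R x)|
      ≤ ∫ x, |g x * (Real.exp (2 * u x) * R x)| := abs_integral_le_integral_abs
    _ ≤ ∫ x, (ε * g x ^ 2 + ε⁻¹ *
          (ball (0 : Eu 4) ρ)ᶜ.indicator (fun x => R x ^ 2 * Real.exp (4 * u x)) x) := by
        refine integral_mono_of_nonneg (Eventually.of_forall fun x => abs_nonneg _)
          ((hg2.const_mul ε).add (ht.const_mul _)) (Eventually.of_forall fun x => ?_)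
        by_cases hx : x ∈ ball (0 : Eu 4) ρ
        · simp [hg0 x hx, hx]
        · simp only [indicator_of_mem (mem_compl hx)]
          have hexp : Real.exp (4 * u x) = Real.exp (2 * u x) ^ 2 := by
            rw [← Real.exp_nat_mul]; ring_nf
          rw [hexp, ← mul_pow, mul_comm (R x)]
          exact abs_mul_le_add_sq hε _ _
    _ = ε * (∫ x, g x ^ 2) +
          ε⁻¹ * ∫ x in (ball (0 : Eu 4) ρ)ᶜ, R x ^ 2 * Real.exp (4 * u x) := by
        rw [integral_add (hg2.const_mul ε) (ht.const_mul _), integral_const_mul,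
          integral_const_mul, integral_indicator measurableSet_ball.compl]
    _ ≤ _ := by
        gcongr

lemma tendsto_setIntegral_compl_ball {h : Eu 4 → ℝ} (hh : Integrable h) :
    Tendsto (fun n : ℕ => ∫ x in (ball (0 : Eu 4) (n + 1))ᶜ, h x) atTop (nhds 0) := by
  have hanti : Antitone fun n : ℕ => (ball (0 : Eu 4) (n + 1))ᶜ := fun m n hmn =>
    compl_subset_compl.2 (ball_subset_ball (by gcongr))
  have hlim := tendsto_setIntegral_of_antitone (μ := volume) (f := h)
    (fun n : ℕ => (measurableSet_ball (x := (0 : Eu 4)) (ε := n + 1)).compl) hanti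
    ⟨0, hh.integrableOn⟩
  have hempty : ⋂ n : ℕ, (ball (0 : Eu 4) (n + 1))ᶜ = ∅ := by
    refine eq_empty_of_forall_notMem fun x hx => ?_
    obtain ⟨n, hn⟩ := exists_nat_gt ‖x‖
    have := mem_iInter.1 hx n
    simp only [mem_compl_iff, mem_ball_zero_iff, not_lt] at this
    linarith
  simpa [hempty] using hlim

lemma tendsto_integral_cutoff_mul {h : Eu 4 → ℝ} (hh : Integrable h) :
    Tendsto (fun n : ℕ => ∫ x, cutoff (n + 1) x * h x) atTop (nhds (∫ x, h x)) := by
  refine tendsto_integral_of_dominated_convergence (fun x => ‖h x‖)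
    (fun n => (contDiff_cutoff _).continuous.aestronglyMeasurable.mul hh.aestronglyMeasurable)
    hh.norm (fun n => Eventually.of_forall fun x => ?_) (Eventually.of_forall fun x => ?_)
  · rw [norm_mul]
    exact mul_le_of_le_one_left (norm_nonneg _) (norm_cutoff_le_one _ x)
  · refine tendsto_const_nhds.congr' ?_
    obtain ⟨N, hN⟩ := exists_nat_gt ‖x‖
    filter_upwards [eventually_ge_atTop N] with n hn
    have hn' : (N : ℝ) ≤ n := by exact_mod_cast hn
    rw [cutoff_of_norm_le (by positivity) (by linarith), one_mul]

lemma contDiff_lap {n : ℕ} {u : Eu n → ℝ} (hu : ContDiff ℝ (⊤ : ℕ∞) u) :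
    ContDiff ℝ (⊤ : ℕ∞) (lap u) := by
  unfold lap
  refine ContDiff.sum fun i _ => ?_
  exact (ContinuousMultilinearMap.apply ℝ (fun _ : Fin 2 => Eu n) ℝ
    ![EuclideanSpace.single i 1, EuclideanSpace.single i 1]).contDiff.comp
      (hu.iteratedFDeriv_right (by norm_cast))

lemma contDiff_gradient {n : ℕ} {u : Eu n → ℝ} (hu : ContDiff ℝ (⊤ : ℕ∞) u) :
    ContDiff ℝ (⊤ : ℕ∞) (gradient u) :=
  (InnerProductSpace.toDual ℝ (Eu n)).symm.contDiff.comp (hu.fderiv_right (by simp))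

lemma gradient_apply {n : ℕ} (u : Eu n → ℝ) (x : Eu n) (i : Fin n) :
    gradient u x i = fderiv ℝ u x (EuclideanSpace.single i 1) := by
  rw [← inner_gradient_left, EuclideanSpace.inner_single_right]
  simp

lemma divergence_smul_gradient {n : ℕ} {u R : Eu n → ℝ} (hu : ContDiff ℝ (⊤ : ℕ∞) u)
    (hR : ContDiff ℝ (⊤ : ℕ∞) R) (x : Eu n) :
    divergence (fun z => Real.exp (2 * u z) • gradient R z) x =
      ∑ i : Fin n, fderiv ℝ (fun z => Real.exp (2 * u z) *
        fderiv ℝ R z (EuclideanSpace.single i 1)) x (EuclideanSpace.single i 1) := by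
  have hW : ContDiff ℝ (⊤ : ℕ∞) fun z => Real.exp (2 * u z) • gradient R z :=
    (contDiff_const.mul hu).exp.smul (contDiff_gradient hR)
  refine Finset.sum_congr rfl fun i _ => ?_
  have h := ((EuclideanSpace.proj (𝕜 := ℝ) i).hasFDerivAt.comp x
    (hW.differentiable (by simp) x).hasFDerivAt).fderiv
  have he : (fun z => Real.exp (2 * u z) * fderiv ℝ R z (EuclideanSpace.single i 1)) =
      (EuclideanSpace.proj (𝕜 := ℝ) i : Eu n →L[ℝ] ℝ) ∘
        fun z => Real.exp (2 * u z) • gradient R z := by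
    ext z
    simp [gradient_apply]
  rw [he, h]
  simp

/-- The total integral of `div(e^{2u}∇R)` vanishes as soon as `e^{2u}R ∈ L²` and
`∫_{B_r} |∇u|² = O(r²)`. -/
lemma integral_divergence_eq_zero {u R : Eu 4 → ℝ} (hu : ContDiff ℝ (⊤ : ℕ∞) u)
    (hR : ContDiff ℝ (⊤ : ℕ∞) R)
    (hRL2 : Integrable fun x => R x ^ 2 * Real.exp (4 * u x))
    (hgrad : ∀ v, ∃ c : ℝ, ∀ r : ℝ, 0 < r →
      ∫ x in ball (0 : Eu 4) r, fderiv ℝ u x v ^ 2 ≤ c * r ^ 2)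
    (hdiv : Integrable fun x => divergence (fun z => Real.exp (2 * u z) • gradient R z) x) :
    ∫ x, divergence (fun z => Real.exp (2 * u z) • gradient R z) x = 0 := by
  choose c hc using hgrad
  choose K hK using fun v => exists_abs_integral_cutoff_mul_le hu hR hRL2 (hc v)
  set T : ℕ → ℝ := fun n => ∫ x in (ball (0 : Eu 4) (n + 1))ᶜ, R x ^ 2 * Real.exp (4 * u x)
  set S : ℝ := ∑ i : Fin 4, K (EuclideanSpace.single i 1)
  have hbound : ∀ ε : ℝ, 0 < ε → ∀ n : ℕ,
      |∫ x, cutoff (n + 1) x * divergence (fun z => Real.exp (2 * u z) • gradient R z) x| ≤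
        ε * S + 4 * (ε⁻¹ * T n) := by
    intro ε hε n
    have hn : (0 : ℝ) < (n : ℝ) + 1 := by positivity
    have hint : ∀ i : Fin 4, Integrable fun x => cutoff (n + 1) x *
        fderiv ℝ (fun z => Real.exp (2 * u z) * fderiv ℝ R z (EuclideanSpace.single i 1)) x
          (EuclideanSpace.single i 1) := by
      intro i
      have hW : ContDiff ℝ (⊤ : ℕ∞) fun z =>
          Real.exp (2 * u z) * fderiv ℝ R z (EuclideanSpace.single i 1) :=
        (contDiff_const.mul hu).exp.mul ((hR.fderiv_right (by simp)).clm_apply contDiff_const)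
      exact ((contDiff_cutoff _).continuous.mul ((hW.continuous_fderiv (by simp)).clm_apply
        continuous_const)).integrable_of_hasCompactSupport (hasCompactSupport_cutoff hn).mul_right
    simp only [divergence_smul_gradient hu hR, Finset.mul_sum]
    rw [integral_finsetSum _ fun i _ => hint i]
    calc _ ≤ ∑ i : Fin 4, (ε * K (EuclideanSpace.single i 1) + ε⁻¹ * T n) :=
          (Finset.abs_sum_le_sum_abs _ _).trans (Finset.sum_le_sum fun i _ => hK _ ε hε _ hn)
      _ = _ := by simp [Finset.sum_add_distrib, S, Finset.mul_sum]
  have hT : Tendsto T atTop (nhds 0) := tendsto_setIntegral_compl_ball hRL2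
  have hle : ∀ ε : ℝ, 0 < ε →
      |∫ x, divergence (fun z => Real.exp (2 * u z) • gradient R z) x| ≤ ε * S := by
    intro ε hε
    have hlim : Tendsto (fun n => ε * S + 4 * (ε⁻¹ * T n)) atTop (nhds (ε * S)) := by
      simpa using ((hT.const_mul ε⁻¹).const_mul 4).const_add (ε * S)
    exact le_of_tendsto_of_tendsto' (tendsto_integral_cutoff_mul hdiv).abs hlim (hbound ε hε)
  have hlim0 : Tendsto (fun ε : ℝ => ε * S) (nhdsWithin 0 (Ioi 0)) (nhds 0) := by
    have : Tendsto (fun ε : ℝ => ε * S) (nhds 0) (nhds (0 * S)) := tendsto_id.mul_const S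
    rw [zero_mul] at this
    exact this.mono_left nhdsWithin_le_nhds
  refine abs_nonpos_iff.1 (ge_of_tendsto hlim0 ?_)
  filter_upwards [self_mem_nhdsWithin] with ε hε using hle ε hε

/-- `g + C` is not integrable on `ℝ⁴` for `C ≠ 0`, so its Bochner integral is `0` by convention. -/
lemma integral_add_const_eq_zero {g : Eu 4 → ℝ} (hg : Integrable g) {C : ℝ} (hC : C ≠ 0) :
    ∫ y, (g y + C) = 0 := by
  refine integral_undef fun h => ?_
  have hconst : Integrable fun _ : Eu 4 => C :=
    (h.sub hg).congr (Eventually.of_forall fun y => by simp)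
  rw [integrable_const_iff] at hconst
  rcases hconst with h0 | hfin
  · exact hC h0
  · exact absurd hfin.measure_univ_lt_top (by simp)
/-- **Vanishing of the total `Δ_g R_g` (Lemma 3.1).** On `ℝ⁴` with `f = Δ²u` integrable,
the metric `e^{2u}|dx|²` normal, `∫ R² e^{4u} < ∞` and `div(e^{2u}∇R)` integrable, one has
`∫ div(e^{2u}∇R) dx = 0`, i.e. `∫ Δ_g R_g dv_g = 0`. -/
theorem total_laplacian_scalar_vanishes
    (u : Eu 4 → ℝ) (hu : ContDiff ℝ (⊤ : ℕ∞) u)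
    (f : Eu 4 → ℝ) (hf : ∀ x, f x = lapIter 2 u x)
    (R : Eu 4 → ℝ)
    (hR : ∀ x, R x = -6 * Real.exp (-2 * u x) * (lap u x + ‖gradient u x‖ ^ 2))
    (hfL1 : Integrable f)
    (hnormal : ∃ C : ℝ, ∀ x : Eu 4,
      u x = (1 / (8 * Real.pi ^ 2)) * ∫ y, Real.log (‖y‖ / ‖x - y‖) * f y + C)
    (hRL2 : Integrable (fun x => R x ^ 2 * Real.exp (4 * u x)))
    (hdivL1 : Integrable
      (fun x => divergence (fun z => Real.exp (2 * u z) • gradient R z) x)) :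
    (∫ x, divergence (fun z => Real.exp (2 * u z) • gradient R z) x) = 0 := by
  have hfc : Continuous f := by
    have : f = lapIter 2 u := funext hf
    rw [this]
    exact (contDiff_lap (contDiff_lap hu)).continuous
  have hRs : ContDiff ℝ (⊤ : ℕ∞) R := by
    have : R = fun x => -6 * Real.exp (-2 * u x) * (lap u x + ‖gradient u x‖ ^ 2) := funext hR
    rw [this]
    exact (contDiff_const.mul (contDiff_const.mul hu).exp).mul
      ((contDiff_lap hu).add ((contDiff_gradient hu).norm_sq ℝ))
  obtain ⟨C, hC⟩ := hnormal
  have hpot : ∃ a, ∀ x, u x = a * (∫ y, Real.log (‖y‖ / ‖x - y‖) * f y) + 0 := by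
    rcases eq_or_ne C 0 with rfl | hC0
    · exact ⟨_, fun x => by simpa using hC x⟩
    · refine ⟨0, fun x => ?_⟩
      rw [hC x, integral_add_const_eq_zero (integrable_log_div_mul hfc hfL1 x) hC0]
      simp
  obtain ⟨a, ha⟩ := hpot
  exact integral_divergence_eq_zero hu hRs hRL2
    (fun v => exists_setIntegral_fderiv_sq_le hu hfc hfL1 ha v) hdivL1
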